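/- Let n ≥ 6 and let 𝓕 be a finite set of graphs. Let c : 𝒢_n → {0,1} be a concept such that, for every T ≥ 0, the normalized 1-WL feature vectors of the graphs in 𝒢_n are NOT linearly separable with respect to c. Assume that every graph G ∈ 𝒢_n with c(G) = 0 has at least one vertex contained in a subgraph of G isomorphic to some member of 𝓕, while no graph G with c(G) = 1 has such a vertex. Then for every T ≥ 0, the normalized 1-WL_𝓕 feature vectors of the graphs in 𝒢_n are linearly separable with respect to c. -/

import Mathlib

open scoped Classical

noncomputable section

/-- The type of 1-WL colors after `t` rounds, with initial colors in `A`.  A color at round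
`t+1` is the pair of the color at round `t` together with the multiset of the neighbors'
colors at round `t`; this encodes the colorings of the Weisfeiler--Leman algorithm up to the
injective renaming `RELABEL`. -/
def WLColor (A : Type) : ℕ → Type :=
  fun t => Nat.rec A (fun _ C => C × Multiset C) t

/-- The 1-WL coloring after `t` rounds of a finite graph `G` with initial labeling `lab`:
`C_0 := lab` and `C_{t+1}(v) := (C_t(v), {{C_t(u) : u ∈ N(v)}})`. -/
def wlColoring {V A : Type} [Fintype V] (G : SimpleGraph V) (lab : V → A) :
    (t : ℕ) → V → WLColor A t :=
  fun t => Nat.rec (motive := fun t => V → WLColor A t) lab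
    (fun _ ih v => (ih v, ((Finset.univ.filter fun u => G.Adj v u).val.map ih))) t

/-- The number of vertices of `G` having 1-WL color `c` at round `t`
(an entry of the WL feature vector `φ_t(G)`). -/
def wlCount {V A : Type} [Fintype V] (G : SimpleGraph V) (lab : V → A) (t : ℕ)
    (c : WLColor A t) : ℕ :=
  (Finset.univ.filter fun v => wlColoring G lab t v = c).card

/-- The set `Σ_t` of colors appearing in `G` at round `t`. -/
def wlColors {V A : Type} [Fintype V] (G : SimpleGraph V) (lab : V → A) (t : ℕ) :
    Finset (WLColor A t) :=
  Finset.univ.image (wlColoring G lab t)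

/-- The constant labeling of an unlabeled graph. -/
def unlab {V : Type} : V → ℕ := fun _ => 0

/-- A bundled finite graph. -/
structure FinGraph where
  n : ℕ
  adj : SimpleGraph (Fin n)

/-- `v` is contained in a vertex subset `X` of `G` such that the induced subgraph `G[X]`
is isomorphic to `F`. -/
def inSubCopy {V : Type} (G : SimpleGraph V) (F : FinGraph) (v : V) : Prop :=
  ∃ X : Finset V, v ∈ X ∧ Nonempty (G.induce (X : Set V) ≃g F.adj)

/-- The initial labeling `ℓ_𝓕` of the `1`-WL_𝓕 algorithm: two vertices get the same label
iff they agree, for every `F ∈ 𝓕`, on containment in a vertex subset inducing a subgraph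
isomorphic to `F`. -/
def ellF {V : Type} (G : SimpleGraph V) (FF : Finset FinGraph) : V → Set FinGraph :=
  fun v => {F | F ∈ FF ∧ inSubCopy G F v}

/-- The Euclidean norm of the WL feature vector `φ^{(T)}(G)`. -/
def wlNorm {V A : Type} [Fintype V] (G : SimpleGraph V) (lab : V → A) (T : ℕ) : ℝ :=
  Real.sqrt (∑ t ∈ Finset.range (T + 1), ∑ c ∈ wlColors G lab t,
    ((wlCount G lab t c : ℝ)) ^ 2)

/-- Inner product `⟨w, φ^{(T)}(G)⟩` of a weight vector `w` (one weight for every round and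
every color) with the WL feature vector of `G`; the sum may range over the colors occurring
in `G` because all other coordinates of the feature vector vanish. -/
def wlIP {V A : Type} [Fintype V] (w : (t : ℕ) → WLColor A t → ℝ) (G : SimpleGraph V)
    (lab : V → A) (T : ℕ) : ℝ :=
  ∑ t ∈ Finset.range (T + 1), ∑ c ∈ wlColors G lab t, w t c * (wlCount G lab t c : ℝ)

/-- Linear separability of the family `{(G, cl G) : G ∈ S}` with respect to a feature map
whose inner products with hyperplane normal vectors `w` are given by `ip`. -/
def LinSepBy {X A : Type} (S : Finset X) (cl : X → Bool)
    (ip : ((t : ℕ) → WLColor A t → ℝ) → X → ℝ) : Prop :=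
  ∃ (w : (t : ℕ) → WLColor A t → ℝ) (b : ℝ), ∀ G ∈ S,
    (cl G = true → 0 < ip w G + b) ∧ (cl G = false → ip w G + b < 0)

/-- The weight vector that weighs the initial labels by `g` and ignores all later rounds. -/
def initialWeight {A : Type} (g : A → ℝ) : (t : ℕ) → WLColor A t → ℝ
  | 0 => g
  | _ + 1 => fun _ => 0

theorem wlIP_initialWeight {V A : Type} [Fintype V] (g : A → ℝ) (G : SimpleGraph V)
    (lab : V → A) (T : ℕ) : wlIP (initialWeight g) G lab T = ∑ v, g (lab v) := by
  have hcomp : ∑ v, initialWeight g 0 (wlColoring G lab 0 v)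
      = ∑ c ∈ wlColors G lab 0, wlCount G lab 0 c • initialWeight g 0 c :=
    Finset.sum_comp (initialWeight g 0) (wlColoring G lab 0)
  unfold wlIP
  rw [Finset.sum_range_succ', Finset.sum_eq_zero fun t _ => by simp [initialWeight], zero_add]
  exact (Finset.sum_congr rfl fun c _ => by rw [nsmul_eq_mul, mul_comm]).trans hcomp.symm

theorem wlCount_pos {V A : Type} [Fintype V] (G : SimpleGraph V) (lab : V → A) (t : ℕ)
    (v : V) : 0 < wlCount G lab t (wlColoring G lab t v) :=
  Finset.card_pos.mpr ⟨v, by simp⟩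

theorem wlColoring_mem_wlColors {V A : Type} [Fintype V] (G : SimpleGraph V) (lab : V → A)
    (t : ℕ) (v : V) : wlColoring G lab t v ∈ wlColors G lab t :=
  Finset.mem_image_of_mem _ (Finset.mem_univ v)

theorem wlNorm_pos {V A : Type} [Fintype V] (G : SimpleGraph V) (lab : V → A) (T : ℕ)
    (v : V) : 0 < wlNorm G lab T := by
  refine Real.sqrt_pos.mpr (Finset.sum_pos' (fun _ _ => by positivity) ⟨0, by simp, ?_⟩)
  refine Finset.sum_pos' (fun _ _ => by positivity)
    ⟨_, wlColoring_mem_wlColors G lab 0 v, ?_⟩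
  have := wlCount_pos G lab 0 v
  positivity

/-- A set of initial labels that occurs in every graph of class `0` and in no graph of class
`1` separates the two classes under the normalized WL feature vectors. -/
theorem linSepBy_of_label {V A : Type} [Fintype V] (S : Finset (SimpleGraph V))
    (cl : SimpleGraph V → Bool) (lab : SimpleGraph V → V → A) (L : Set A)
    (h0 : ∀ G ∈ S, cl G = false → ∃ v, lab G v ∈ L)
    (h1 : ∀ G ∈ S, cl G = true → ∀ v, lab G v ∉ L) (T : ℕ) :
    LinSepBy S cl (fun w G => wlIP w G (lab G) T / wlNorm G (lab G) T) := by
  have norm_nonneg (G : SimpleGraph V) : 0 ≤ wlNorm G (lab G) T := Real.sqrt_nonneg _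
  set M : ℝ := 1 + ∑ G ∈ S, wlNorm G (lab G) T
  have hMpos : 0 < M := by
    have := Finset.sum_nonneg fun G (_ : G ∈ S) => norm_nonneg G
    linarith
  refine ⟨initialWeight fun a => if a ∈ L then -1 else 0, 1 / M, fun G hG =>
    ⟨fun hc => ?_, fun hc => ?_⟩⟩ <;> beta_reduce <;> rw [wlIP_initialWeight]
  · rw [Finset.sum_eq_zero fun v _ => if_neg (h1 G hG hc v), zero_div, zero_add]
    positivity
  · obtain ⟨v, hv⟩ := h0 G hG hc
    have hN := wlNorm_pos G (lab G) T v
    have hlt : wlNorm G (lab G) T < M := by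
      have := Finset.single_le_sum (fun G _ => norm_nonneg G) hG
      linarith
    have hsum : ∑ u, (if lab G u ∈ L then (-1 : ℝ) else 0) ≤ -1 := by
      rw [← Finset.add_sum_erase _ _ (Finset.mem_univ v), if_pos hv]
      have hrest : ∑ u ∈ Finset.univ.erase v, (if lab G u ∈ L then (-1 : ℝ) else 0) ≤ 0 :=
        Finset.sum_nonpos fun u _ => by split_ifs <;> norm_num
      linarith
    have hdiv := div_le_div_of_nonneg_right hsum hN.le
    have hinv := one_div_lt_one_div_of_lt hN hlt
    rw [neg_div] at hdiv
    exact lt_of_le_of_lt (add_le_add_left hdiv _) (by linarith)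

/-- Let `n ≥ 6`, let `𝓕` be a finite set of graphs, and let
`cl : 𝒢_n → {0,1}` be a concept such that the `n`-order graphs are not linearly separable
with respect to `cl` under the normalized `1`-WL feature vectors for any `T ≥ 0`.  If every
graph of class `0` has a vertex contained in a subgraph isomorphic to a member of `𝓕`,
while no graph of class `1` has such a vertex, then for every `T ≥ 0` the `n`-order graphs
are linearly separable with respect to `cl` under the normalized `1`-WL_𝓕 feature
vectors. -/
theorem wlF_separates (n : ℕ) (hn : 6 ≤ n) (FF : Finset FinGraph)
    (cl : SimpleGraph (Fin n) → Bool)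
    (hnotsep : ∀ T : ℕ, ¬ LinSepBy (Finset.univ : Finset (SimpleGraph (Fin n))) cl
      (fun w G => wlIP w G unlab T / wlNorm G unlab T))
    (h0 : ∀ G : SimpleGraph (Fin n), cl G = false → ∃ v, ∃ F ∈ FF, inSubCopy G F v)
    (h1 : ∀ G : SimpleGraph (Fin n), cl G = true → ∀ v, ∀ F ∈ FF, ¬ inSubCopy G F v) :
    ∀ T : ℕ, LinSepBy (Finset.univ : Finset (SimpleGraph (Fin n))) cl
      (fun w G => wlIP w G (ellF G FF) T / wlNorm G (ellF G FF) T) := by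
  refine linSepBy_of_label _ cl (fun G => ellF G FF) {a | a.Nonempty} (fun G _ hc => ?_)
    (fun G _ hc v => ?_)
  · obtain ⟨v, F, hF, hv⟩ := h0 G hc
    exact ⟨v, F, hF, hv⟩
  · rintro ⟨F, hF, hv⟩
    exact h1 G hc v F hF hv

end
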